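/- arXiv:1008.2469 — 8 statements merged into one kernel-verified Lean document; each statement's English description precedes it below -/
import Mathlib

section
/- (Theorem 4.2 i.) Suppose 0 ≤ c < 1 and ‖V x‖ ≤ c‖G x‖ for all x ∈ D. Then the form polynomial t is strongly damped and for every x ∈ D ∖ {0} one has p_−(x) ≤ −m + c m and p_+(x) ≥ m − c m; equivalently, ν_− ≤ −m + c m < 0 < m − c m ≤ ν_+. In particular, t(λ)[x] > 0 for every λ ∈ (−m + c m, m − c m) and every x ∈ D ∖ {0}. -/
/-- The abstract Klein–Gordon quadratic form `t(λ)[x] = ‖G x‖² − ‖V x − λ x‖²`. -/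
noncomputable def kgForm {H : Type*} [NormedAddCommGroup H] [InnerProductSpace ℂ H]
    {D : Submodule ℂ H} (G V : D →ₗ[ℂ] H) (μ : ℝ) (x : D) : ℝ :=
  ‖G x‖ ^ 2 - ‖V x - (μ : ℂ) • (x : H)‖ ^ 2

/-- The Klein–Gordon form as an explicit quadratic polynomial in the spectral parameter. -/
theorem kgForm_eq_quadratic {H : Type*} [NormedAddCommGroup H] [InnerProductSpace ℂ H]
    {D : Submodule ℂ H} (G V : D →ₗ[ℂ] H) (μ : ℝ) (x : D) :
    kgForm G V μ x = kgForm G V 0 x + 2 * (inner ℂ (V x) (x : H)).re * μ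
      - ‖(x : H)‖ ^ 2 * μ ^ 2 := by
  have h := norm_sub_sq (𝕜 := ℂ) (V x) ((μ : ℂ) • (x : H))
  rw [inner_smul_right, norm_smul, Complex.norm_real, Real.norm_eq_abs, mul_pow, sq_abs] at h
  simp only [RCLike.re_to_complex, Complex.re_ofReal_mul] at h
  simp only [kgForm, h, Complex.ofReal_zero, zero_smul, sub_zero]
  ring

/-- The Klein–Gordon form is positive on the gap `(−(1 − c) m, (1 − c) m)`. -/
theorem kgForm_pos_of_abs_lt {H : Type*} [NormedAddCommGroup H] [InnerProductSpace ℂ H]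
    {D : Submodule ℂ H} {G V : D →ₗ[ℂ] H} {m c μ : ℝ} {x : D} (hx : x ≠ 0)
    (hG : m * ‖(x : H)‖ ≤ ‖G x‖) (hc1 : c < 1) (hV : ‖V x‖ ≤ c * ‖G x‖)
    (hμ : |μ| < (1 - c) * m) : 0 < kgForm G V μ x := by
  have hx0 : 0 < ‖(x : H)‖ := norm_pos_iff.mpr (by simpa using hx)
  have htri := norm_sub_le (V x) ((μ : ℂ) • (x : H))
  rw [norm_smul, Complex.norm_real, Real.norm_eq_abs] at htri
  have h₁ := mul_lt_mul_of_pos_right hμ hx0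
  have h₂ := mul_le_mul_of_nonneg_left hG (sub_nonneg.mpr hc1.le)
  have hlt : ‖V x - (μ : ℂ) • (x : H)‖ < ‖G x‖ := by linarith
  exact sub_pos.mpr (pow_lt_pow_left₀ hlt (norm_nonneg _) two_ne_zero)

/-- A real quadratic with negative leading coefficient and positive constant term splits into
linear factors with one negative and one positive zero. -/
theorem exists_neg_pos_factorization {a e : ℝ} (b : ℝ) (ha : 0 < a) (he : 0 < e) :
    ∃ p q : ℝ, p < 0 ∧ 0 < q ∧
      ∀ μ : ℝ, e + 2 * b * μ - a * μ ^ 2 = -(a * ((μ - p) * (μ - q))) := by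
  have hae : 0 < a * e := mul_pos ha he
  have hs : √(b ^ 2 + a * e) ^ 2 = b ^ 2 + a * e := Real.sq_sqrt (by positivity)
  have habs : |b| < √(b ^ 2 + a * e) := by
    rw [← Real.sqrt_sq_eq_abs]
    exact Real.sqrt_lt_sqrt (sq_nonneg b) (by linarith)
  obtain ⟨hb₁, hb₂⟩ := abs_lt.mp habs
  refine ⟨(b - √(b ^ 2 + a * e)) / a, (b + √(b ^ 2 + a * e)) / a,
    div_neg_of_neg_of_pos (by linarith) ha, div_pos (by linarith) ha, fun μ => ?_⟩
  generalize √(b ^ 2 + a * e) = s at hs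
  field_simp
  linear_combination -hs

/-- Theorem 4.2 i): if `‖V x‖ ≤ c ‖G x‖` on `D` with `0 ≤ c < 1` (and `‖G x‖ ≥ m ‖x‖`,
`m > 0`), then the form polynomial `t` is strongly damped, its roots satisfy
`p₋(x) ≤ −m + c m` and `p₊(x) ≥ m − c m`, and `t(λ)[x] > 0` for every
`λ ∈ (−m + c m, m − c m)` and every `x ∈ D ∖ {0}`. -/
theorem strongly_damped_of_contraction
    {H : Type*} [NormedAddCommGroup H] [InnerProductSpace ℂ H]
    (m : ℝ) (hm : 0 < m) (D : Submodule ℂ H) (G V : D →ₗ[ℂ] H)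
    (hG : ∀ x : D, m * ‖(x : H)‖ ≤ ‖G x‖)
    (c : ℝ) (hc0 : 0 ≤ c) (hc1 : c < 1)
    (hV : ∀ x : D, ‖V x‖ ≤ c * ‖G x‖) :
    (∀ x : D, x ≠ 0 → ∃ p q : ℝ, p < q ∧
      kgForm G V p x = 0 ∧ kgForm G V q x = 0 ∧
      (∀ μ : ℝ, kgForm G V μ x = 0 → μ = p ∨ μ = q) ∧
      p ≤ -m + c * m ∧ m - c * m ≤ q) ∧
    (∀ lam : ℝ, -m + c * m < lam → lam < m - c * m →
      ∀ x : D, x ≠ 0 → 0 < kgForm G V lam x) := by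
  have hpos : ∀ μ : ℝ, -m + c * m < μ → μ < m - c * m →
      ∀ x : D, x ≠ 0 → 0 < kgForm G V μ x := fun μ h₁ h₂ x hx =>
    kgForm_pos_of_abs_lt hx (hG x) hc1 (hV x) (abs_lt.mpr ⟨by linarith, by linarith⟩)
  refine ⟨fun x hx => ?_, hpos⟩
  have hd : 0 < (1 - c) * m := mul_pos (sub_pos.mpr hc1) hm
  have ha : 0 < ‖(x : H)‖ ^ 2 := pow_pos (norm_pos_iff.mpr (by simpa using hx)) 2
  obtain ⟨p, q, hp, hq, hpq⟩ := exists_neg_pos_factorization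
    (inner ℂ (V x) (x : H)).re ha (hpos 0 (by linarith) (by linarith) x hx)
  have hfac : ∀ μ : ℝ, kgForm G V μ x = -(‖(x : H)‖ ^ 2 * ((μ - p) * (μ - q))) :=
    fun μ => (kgForm_eq_quadratic G V μ x).trans (hpq μ)
  have hp0 : kgForm G V p x = 0 := by simp [hfac]
  have hq0 : kgForm G V q x = 0 := by simp [hfac]
  refine ⟨p, q, hp.trans hq, hp0, hq0, fun μ hμ => ?_, ?_, ?_⟩
  · rw [hfac, neg_eq_zero, mul_eq_zero, mul_eq_zero, sub_eq_zero, sub_eq_zero] at hμ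
    exact hμ.resolve_left ha.ne'
  · by_contra! h
    exact (hpos p h (by linarith) x hx).ne' hp0
  · by_contra! h
    exact (hpos q (by linarith) h x hx).ne' hq0
end

section
/- (Uniform positivity of the Klein–Gordon form on the spectral gap, Theorem 6.1.) For every smooth compactly supported function Ψ : ℝⁿ → ℂ one has ∫|∇Ψ|² + m² ∫_{ℝⁿ} |Ψ|² − ∫_{ℝⁿ} |(w(x) − λ)Ψ(x)|² dx ≥ ε² ∫_{ℝⁿ} |Ψ|²; that is, the Klein–Gordon form t(λ)[Ψ] := ∫|∇Ψ|² + m²‖Ψ‖² − ‖(w − λ)Ψ‖² is uniformly positive for every λ in the spectral gap (q₋, q₊). -/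
open MeasureTheory

section Hardy

open Filter Topology

/-- A directional derivative of a compactly supported `C¹` function has vanishing integral. -/
lemma integral_fderiv_apply_eq_zero {E : Type*} [NormedAddCommGroup E] [NormedSpace ℝ E]
    [FiniteDimensional ℝ E] [MeasurableSpace E] [BorelSpace E] (μ : Measure E)
    [μ.IsAddHaarMeasure] {g : E → ℝ} (hg : ContDiff ℝ 1 g) (hgs : HasCompactSupport g) (v : E) :
    ∫ x, fderiv ℝ g x v ∂μ = 0 := by
  have hc : Continuous fun x => fderiv ℝ g x v :=
    (hg.continuous_fderiv one_ne_zero).clm_apply continuous_const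
  have h := integral_mul_fderiv_eq_neg_fderiv_mul_of_integrable (μ := μ) (𝕜 := ℝ)
    (f := fun _ : E => (1 : ℝ)) (g := g) (v := v) (by simp)
    (by simpa using hc.integrable_of_hasCompactSupport (hgs.fderiv_apply ℝ v))
    (by simpa using hg.continuous.integrable_of_hasCompactSupport hgs)
    (fun x _ => differentiableAt_const _) (fun x _ => (hg.differentiable one_ne_zero) x)
  simpa using h

lemma hasCompactSupport_norm_sq {E F : Type*} [TopologicalSpace E] [NormedAddCommGroup F]
    {f : E → F} (hs : HasCompactSupport f) : HasCompactSupport fun x => ‖f x‖ ^ 2 :=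
  hs.comp_left (g := fun z : F => ‖z‖ ^ 2) (by simp)

lemma integrable_norm_sq {E F : Type*} [TopologicalSpace E] [MeasurableSpace E]
    [OpensMeasurableSpace E] [NormedAddCommGroup F] {μ : Measure E}
    [IsFiniteMeasureOnCompacts μ] {f : E → F} (hf : Continuous f) (hs : HasCompactSupport f) :
    Integrable (fun x => ‖f x‖ ^ 2) μ := by
  have hc : Continuous fun x => ‖f x‖ ^ 2 := by fun_prop
  exact hc.integrable_of_hasCompactSupport (hasCompactSupport_norm_sq hs)

variable {n : ℕ} {Ψ : EuclideanSpace ℝ (Fin n) → ℂ}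

lemma fderiv_norm_sq_mul_coord_div {δ : ℝ} (hδ : 0 < δ) (hΨ : Differentiable ℝ Ψ)
    (x : EuclideanSpace ℝ (Fin n)) (j : Fin n) :
    fderiv ℝ (fun y => ‖Ψ y‖ ^ 2 * (y j * (‖y‖ ^ 2 + δ)⁻¹)) x (EuclideanSpace.single j 1) =
      ‖Ψ x‖ ^ 2 * ((‖x‖ ^ 2 + δ)⁻¹ - 2 * (x j * (‖x‖ ^ 2 + δ)⁻¹) ^ 2) +
        2 * inner ℝ (Ψ x) (fderiv ℝ Ψ x (EuclideanSpace.single j 1)) *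
          (x j * (‖x‖ ^ 2 + δ)⁻¹) := by
  have hs : ‖x‖ ^ 2 + δ ≠ 0 := by positivity
  have h1 := (hΨ x).hasFDerivAt.norm_sq
  have h2 : HasFDerivAt (fun y : EuclideanSpace ℝ (Fin n) => y j)
      (EuclideanSpace.proj j : EuclideanSpace ℝ (Fin n) →L[ℝ] ℝ) x :=
    (EuclideanSpace.proj j : EuclideanSpace ℝ (Fin n) →L[ℝ] ℝ).hasFDerivAt
  have h3 := ((hasStrictFDerivAt_norm_sq x).hasFDerivAt).add_const δ
  have h4 := (hasDerivAt_inv hs).comp_hasFDerivAt x h3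
  have h := h1.mul (h2.mul h4)
  refine (congrArg (fun L => L (EuclideanSpace.single j (1 : ℝ))) h.fderiv).trans ?_
  simp [EuclideanSpace.inner_single_right]
  field_simp
  ring

/-- Hardy's inequality with the weight `‖x‖⁻²` regularized to `(‖x‖² + δ)⁻¹`. -/
lemma hardy_regularized (hn : 2 ≤ n) {δ : ℝ} (hδ : 0 < δ) (hΨ : ContDiff ℝ 1 Ψ)
    (hsupp : HasCompactSupport Ψ) :
    (((n : ℝ) - 2) / 2) ^ 2 * ∫ x, ‖Ψ x‖ ^ 2 * (‖x‖ ^ 2 + δ)⁻¹ ≤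
      ∑ j : Fin n, ∫ x, ‖fderiv ℝ Ψ x (EuclideanSpace.single j 1)‖ ^ 2 := by
  set κ : ℝ := ((n : ℝ) - 2) / 2 with hκ
  have hκ0 : 0 ≤ κ := by
    have : (2 : ℝ) ≤ n := by exact_mod_cast hn
    rw [hκ]; linarith
  have hs : ∀ x : EuclideanSpace ℝ (Fin n), ‖x‖ ^ 2 + δ ≠ 0 := fun x => by positivity
  have hsq : HasCompactSupport fun x => ‖Ψ x‖ ^ 2 :=
    hasCompactSupport_norm_sq hsupp
  let G : Fin n → EuclideanSpace ℝ (Fin n) → ℝ :=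
    fun j y => ‖Ψ y‖ ^ 2 * (y j * (‖y‖ ^ 2 + δ)⁻¹)
  have hG : ∀ j, ContDiff ℝ 1 (G j) := fun j =>
    (hΨ.norm_sq ℝ).mul
      ((EuclideanSpace.proj j : EuclideanSpace ℝ (Fin n) →L[ℝ] ℝ).contDiff.mul
        (((contDiff_norm_sq ℝ).add contDiff_const).inv hs))
  have hGs : ∀ j, HasCompactSupport (G j) := fun j => hsq.mul_right
  have hGi : ∀ j, Integrable fun x => fderiv ℝ (G j) x (EuclideanSpace.single j 1) := fun j =>
    (((hG j).continuous_fderiv one_ne_zero).clm_apply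
      continuous_const).integrable_of_hasCompactSupport ((hGs j).fderiv_apply ℝ _)
  have hDi : ∀ j : Fin n,
      Integrable fun x => ‖fderiv ℝ Ψ x (EuclideanSpace.single j 1)‖ ^ 2 := fun j =>
    integrable_norm_sq ((hΨ.continuous_fderiv one_ne_zero).clm_apply continuous_const)
      (hsupp.fderiv_apply ℝ (EuclideanSpace.single j 1))
  have hWi : Integrable fun x => ‖Ψ x‖ ^ 2 * (‖x‖ ^ 2 + δ)⁻¹ :=
    ((hΨ.continuous.norm.pow 2).mul
      (((continuous_norm.pow 2).add continuous_const).inv₀ hs)).integrable_of_hasCompactSupport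
      hsq.mul_right
  have hpt : ∀ x, κ ^ 2 * (‖Ψ x‖ ^ 2 * (‖x‖ ^ 2 + δ)⁻¹) ≤
      ∑ j : Fin n, (‖fderiv ℝ Ψ x (EuclideanSpace.single j 1)‖ ^ 2 +
        κ * fderiv ℝ (G j) x (EuclideanSpace.single j 1)) := by
    intro x
    set r := (‖x‖ ^ 2 + δ)⁻¹ with hr
    have hr0 : 0 < r := by positivity
    have hterm : ∀ j : Fin n,
        ‖Ψ x‖ ^ 2 * (κ * r) - (2 * κ + κ ^ 2) * ‖Ψ x‖ ^ 2 * r ^ 2 * (x j) ^ 2 ≤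
          ‖fderiv ℝ Ψ x (EuclideanSpace.single j 1)‖ ^ 2 +
            κ * fderiv ℝ (G j) x (EuclideanSpace.single j 1) := by
      intro j
      rw [fderiv_norm_sq_mul_coord_div hδ (hΨ.differentiable one_ne_zero) x j]
      have h := norm_add_sq_real (fderiv ℝ Ψ x (EuclideanSpace.single j 1))
        ((κ * (x j * r)) • Ψ x)
      rw [inner_smul_right, real_inner_comm, norm_smul, mul_pow, Real.norm_eq_abs, sq_abs] at h
      have h0 := sq_nonneg
        ‖fderiv ℝ Ψ x (EuclideanSpace.single j 1) + (κ * (x j * r)) • Ψ x‖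
      rw [h] at h0
      linarith
    refine le_trans ?_ (Finset.sum_le_sum fun j _ => hterm j)
    rw [Finset.sum_sub_distrib, ← Finset.mul_sum Finset.univ (fun j => (x j) ^ 2),
      ← EuclideanSpace.real_norm_sq_eq, Finset.sum_const, Finset.card_univ, Fintype.card_fin,
      nsmul_eq_mul]
    have hnκ : (n : ℝ) = 2 * κ + 2 := by rw [hκ]; ring
    have hxr : r ^ 2 * ‖x‖ ^ 2 ≤ r := by
      have h1 : r * (‖x‖ ^ 2 + δ) = 1 := inv_mul_cancel₀ (hs x)
      nlinarith [mul_pos hr0 (mul_pos hr0 hδ)]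
    have hA : 0 ≤ (2 * κ + κ ^ 2) * ‖Ψ x‖ ^ 2 := by positivity
    rw [hnκ]
    nlinarith [mul_le_mul_of_nonneg_left hxr hA]
  have hint := integral_mono (hWi.const_mul (κ ^ 2))
    (integrable_finsetSum _ fun j _ => (hDi j).add ((hGi j).const_mul κ)) hpt
  rw [integral_const_mul, integral_finsetSum _ fun j _ => (hDi j).add ((hGi j).const_mul κ)]
    at hint
  refine hint.trans_eq (Finset.sum_congr rfl fun j _ => ?_)
  simp only [Pi.add_apply]
  rw [integral_add (hDi j) ((hGi j).const_mul κ), integral_const_mul,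
    integral_fderiv_apply_eq_zero volume (hG j) (hGs j), mul_zero, add_zero]

/-- **Hardy's inequality** in dimension `n ≥ 3`, together with the integrability of
`‖Ψ‖² / ‖x‖²`. -/
theorem hardy_inequality (hn : 3 ≤ n) (hΨ : ContDiff ℝ 1 Ψ) (hsupp : HasCompactSupport Ψ) :
    (Integrable fun x => ‖Ψ x‖ ^ 2 * (‖x‖ ^ 2)⁻¹) ∧
      (((n : ℝ) - 2) / 2) ^ 2 * ∫ x, ‖Ψ x‖ ^ 2 * (‖x‖ ^ 2)⁻¹ ≤
        ∑ j : Fin n, ∫ x, ‖fderiv ℝ Ψ x (EuclideanSpace.single j 1)‖ ^ 2 := by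
  set D := ∑ j : Fin n, ∫ x, ‖fderiv ℝ Ψ x (EuclideanSpace.single j 1)‖ ^ 2
  have hD : 0 ≤ D := Finset.sum_nonneg fun j _ => integral_nonneg fun x => sq_nonneg _
  have hκ : 0 < (((n : ℝ) - 2) / 2) ^ 2 := by
    have : (3 : ℝ) ≤ n := by exact_mod_cast hn
    have : 0 < ((n : ℝ) - 2) / 2 := by linarith
    positivity
  set K := (((n : ℝ) - 2) / 2) ^ 2
  let δ : ℕ → ℝ := fun k => 1 / ((k : ℝ) + 1)
  have hδ : ∀ k, 0 < δ k := fun k => Nat.one_div_pos_of_nat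
  let f : ℕ → EuclideanSpace ℝ (Fin n) → ℝ := fun k x => ‖Ψ x‖ ^ 2 * (‖x‖ ^ 2 + δ k)⁻¹
  have hf0 : ∀ k x, 0 ≤ f k x := fun k x => by have := hδ k; positivity
  have hfc : ∀ k, Continuous (f k) := fun k =>
    (hΨ.continuous.norm.pow 2).mul (((continuous_norm.pow 2).add continuous_const).inv₀
      fun x => (add_pos_of_nonneg_of_pos (sq_nonneg _) (hδ k)).ne')
  have hfi : ∀ k, Integrable (f k) := fun k =>
    (hfc k).integrable_of_hasCompactSupport
      (hasCompactSupport_norm_sq hsupp).mul_right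
  have hbd : ∀ k, ∫⁻ x, ENNReal.ofReal (f k x) ≤ ENNReal.ofReal (D / K) := fun k => by
    rw [← ofReal_integral_eq_lintegral_ofReal (hfi k) (ae_of_all _ (hf0 k))]
    refine ENNReal.ofReal_le_ofReal ((le_div_iff₀' hκ).2 ?_)
    exact hardy_regularized (by omega) (hδ k) hΨ hsupp
  have hF0 : ∀ x : EuclideanSpace ℝ (Fin n), 0 ≤ ‖Ψ x‖ ^ 2 * (‖x‖ ^ 2)⁻¹ :=
    fun x => by positivity
  have hFm : AEStronglyMeasurable (fun x => ‖Ψ x‖ ^ 2 * (‖x‖ ^ 2)⁻¹) volume :=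
    ((hΨ.continuous.norm.pow 2).measurable.mul
      (continuous_norm.pow 2).measurable.inv).aestronglyMeasurable
  have : Nonempty (Fin n) := ⟨⟨0, by omega⟩⟩
  have hlim : Tendsto (fun k => ∫⁻ x, ENNReal.ofReal (f k x)) atTop
      (𝓝 (∫⁻ x, ENNReal.ofReal (‖Ψ x‖ ^ 2 * (‖x‖ ^ 2)⁻¹))) := by
    refine lintegral_tendsto_of_tendsto_of_monotone
      (fun k => (hfc k).measurable.ennreal_ofReal.aemeasurable) ?_ ?_
    · refine ae_of_all _ fun x i j hij => ENNReal.ofReal_le_ofReal ?_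
      have h1 : δ j ≤ δ i := Nat.one_div_le_one_div hij
      have := hδ j
      simp only [f]
      gcongr
    · filter_upwards [Measure.ae_ne volume (0 : EuclideanSpace ℝ (Fin n))] with x hx
      refine (ENNReal.continuous_ofReal.tendsto _).comp (tendsto_const_nhds.mul ?_)
      have hx2 : ‖x‖ ^ 2 ≠ 0 := by positivity
      refine Tendsto.inv₀ ?_ hx2
      simpa only [add_zero] using (tendsto_const_nhds (x := ‖x‖ ^ 2)).add
        (tendsto_one_div_add_atTop_nhds_zero_nat (𝕜 := ℝ))
  have hle := le_of_tendsto' hlim hbd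
  have hint : Integrable fun x => ‖Ψ x‖ ^ 2 * (‖x‖ ^ 2)⁻¹ :=
    ⟨hFm, (hasFiniteIntegral_iff_ofReal (ae_of_all _ hF0)).2
      (hle.trans_lt ENNReal.ofReal_lt_top)⟩
  refine ⟨hint, (le_div_iff₀' hκ).1 ?_⟩
  rw [← ofReal_integral_eq_lintegral_ofReal hint (ae_of_all _ hF0)] at hle
  exact (ENNReal.ofReal_le_ofReal_iff (by positivity)).1 hle

end Hardy

/-- Uniform positivity of the Klein–Gordon form on the spectral gap (Theorem 6.1): if
`|w(x) − λ| ≤ √(m² + γ²/‖x‖²) − ε` a.e. on `ℝⁿ` with `n ≥ 3` and `0 ≤ γ < (n−2)/2`,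
then for every smooth compactly supported `Ψ : ℝⁿ → ℂ`,
`∫ |∇Ψ|² + m² ∫ |Ψ|² − ∫ |(w − λ)Ψ|² ≥ ε² ∫ |Ψ|²`. -/
theorem kg_form_uniformly_positive_on_gap
    (n : ℕ) (hn : 3 ≤ n) (m γ : ℝ) (hm : 0 < m) (hγ0 : 0 ≤ γ)
    (hγ : γ < ((n : ℝ) - 2) / 2)
    (w : EuclideanSpace ℝ (Fin n) → ℝ) (hw : Measurable w)
    (lam ε : ℝ) (hε : 0 < ε)
    (hbound : ∀ᵐ x : EuclideanSpace ℝ (Fin n),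
      |w x - lam| ≤ Real.sqrt (m ^ 2 + γ ^ 2 / ‖x‖ ^ 2) - ε)
    (Ψ : EuclideanSpace ℝ (Fin n) → ℂ)
    (hΨ : ContDiff ℝ (⊤ : ℕ∞) Ψ) (hsupp : HasCompactSupport Ψ) :
    ε ^ 2 * ∫ x : EuclideanSpace ℝ (Fin n), ‖Ψ x‖ ^ 2 ≤
      (∑ j : Fin n, ∫ x : EuclideanSpace ℝ (Fin n),
          ‖fderiv ℝ Ψ x (EuclideanSpace.single j 1)‖ ^ 2) +
        m ^ 2 * (∫ x : EuclideanSpace ℝ (Fin n), ‖Ψ x‖ ^ 2) -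
        ∫ x : EuclideanSpace ℝ (Fin n), (w x - lam) ^ 2 * ‖Ψ x‖ ^ 2 := by
  have hΨ1 : ContDiff ℝ 1 Ψ := hΨ.of_le (by exact_mod_cast le_top)
  obtain ⟨hHi, hH⟩ := hardy_inequality hn hΨ1 hsupp
  have hNi : Integrable fun x => ‖Ψ x‖ ^ 2 :=
    integrable_norm_sq hΨ.continuous hsupp
  have hpt : ∀ᵐ x : EuclideanSpace ℝ (Fin n), (w x - lam) ^ 2 * ‖Ψ x‖ ^ 2 ≤
      (m ^ 2 - ε ^ 2) * ‖Ψ x‖ ^ 2 + γ ^ 2 * (‖Ψ x‖ ^ 2 * (‖x‖ ^ 2)⁻¹) := by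
    filter_upwards [hbound] with x hx
    have h0 := abs_nonneg (w x - lam)
    have hS := Real.sq_sqrt (show 0 ≤ m ^ 2 + γ ^ 2 / ‖x‖ ^ 2 by positivity)
    rw [div_eq_mul_inv] at hx hS
    have h1 : (w x - lam) ^ 2 ≤ m ^ 2 - ε ^ 2 + γ ^ 2 * (‖x‖ ^ 2)⁻¹ := by
      rw [← sq_abs]
      nlinarith [mul_nonneg h0 hε.le]
    calc _ ≤ _ := mul_le_mul_of_nonneg_right h1 (sq_nonneg ‖Ψ x‖)
      _ = _ := by ring
  have hmono := integral_mono_of_nonneg (ae_of_all _ fun x => by positivity)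
    ((hNi.const_mul (m ^ 2 - ε ^ 2)).add (hHi.const_mul (γ ^ 2))) hpt
  simp only [Pi.add_apply] at hmono
  rw [integral_add (hNi.const_mul _) (hHi.const_mul _), integral_const_mul,
    integral_const_mul] at hmono
  have hγ2 : γ ^ 2 ≤ (((n : ℝ) - 2) / 2) ^ 2 := pow_le_pow_left₀ hγ0 hγ.le 2
  have hI0 : 0 ≤ ∫ x, ‖Ψ x‖ ^ 2 * (‖x‖ ^ 2)⁻¹ := integral_nonneg fun x => by positivity
  linarith [mul_le_mul_of_nonneg_right hγ2 hI0]
end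

section
/- (Lemma 3.2: the two root zones of a strongly damped form polynomial are separated.) Assume the form polynomial t is strongly damped. Then p_−(x) < p_+(y) for all x, y ∈ D ∖ {0}. In particular the root zones Λ_− and Λ_+ are disjoint, and sup Λ_− ≤ inf Λ_+ (i.e. ν_− ≤ ν_+). -/
/-- A real quadratic with coefficients of opposite outer signs has a positive root. -/
theorem exists_pos_root_of_opposite_signs {a b c : ℝ} (ha : a < 0) (hc : 0 < c) :
    ∃ s : ℝ, 0 < s ∧ c + s * b + s ^ 2 * a = 0 := by
  have hlt : b ^ 2 < b ^ 2 - 4 * a * c := by nlinarith [mul_pos (neg_pos.2 ha) hc]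
  set r := √(b ^ 2 - 4 * a * c) with hr
  have hr2 : r ^ 2 = b ^ 2 - 4 * a * c := Real.sq_sqrt ((sq_nonneg b).trans hlt.le)
  have habs : |b| < r := by
    rw [← Real.sqrt_sq_eq_abs]
    exact Real.sqrt_lt_sqrt (sq_nonneg b) hlt
  have hbr : 0 < b + r := by linarith [neg_abs_le b]
  refine ⟨(b + r) / (-2 * a), div_pos hbr (by linarith), ?_⟩
  have ha0 : a ≠ 0 := ha.ne
  field_simp
  linear_combination hr2

/-- Such a quadratic has a root of any prescribed (weak) sign. -/
theorem exists_root_of_opposite_signs_mul_nonpos {a b c : ℝ} (ha : a < 0) (hc : 0 < c) (d : ℝ) :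
    ∃ s : ℝ, s * d ≤ 0 ∧ c + s * b + s ^ 2 * a = 0 := by
  rcases le_total d 0 with hd | hd
  · obtain ⟨s, hs, h⟩ := exists_pos_root_of_opposite_signs (b := b) ha hc
    exact ⟨s, mul_nonpos_of_nonneg_of_nonpos hs.le hd, h⟩
  · obtain ⟨s, hs, h⟩ := exists_pos_root_of_opposite_signs (b := -b) ha hc
    exact ⟨-s, mul_nonpos_of_nonpos_of_nonneg (neg_nonpos.2 hs.le) hd, by linear_combination h⟩

section

variable {H : Type*} [NormedAddCommGroup H] [InnerProductSpace ℂ H]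

theorem norm_add_ofReal_smul_sq (u v : H) (s : ℝ) :
    ‖u + (s : ℂ) • v‖ ^ 2 = ‖u‖ ^ 2 + 2 * s * (inner ℂ u v).re + s ^ 2 * ‖v‖ ^ 2 := by
  rw [norm_add_sq (𝕜 := ℂ), norm_smul, inner_smul_right, mul_pow, Complex.norm_real,
    Real.norm_eq_abs, sq_abs, RCLike.re_to_complex, Complex.re_ofReal_mul]
  ring

variable {D : Submodule ℂ H} (G V : D →ₗ[ℂ] H)

/-- Half the derivative of `λ ↦ t(λ)[x]` at `μ`. -/
noncomputable def kgHalfDeriv (μ : ℝ) (x : D) : ℝ :=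
  (inner ℂ (V x - (μ : ℂ) • (x : H)) (x : H)).re

theorem kgForm_eq_taylor (μ l : ℝ) (x : D) :
    kgForm G V l x =
      kgForm G V μ x + 2 * (l - μ) * kgHalfDeriv V μ x - (l - μ) ^ 2 * ‖(x : H)‖ ^ 2 := by
  have h : V x - (l : ℂ) • (x : H) =
      (V x - (μ : ℂ) • (x : H)) + ((μ - l : ℝ) : ℂ) • (x : H) := by
    push_cast
    module
  rw [kgForm, kgForm, h, norm_add_ofReal_smul_sq, kgHalfDeriv]
  ring

theorem exists_kgForm_add_smul (μ : ℝ) (x y : D) :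
    ∃ c : ℝ, ∀ s : ℝ, kgForm G V μ (x + (s : ℂ) • y) =
      kgForm G V μ x + s * c + s ^ 2 * kgForm G V μ y := by
  refine ⟨2 * (inner ℂ (G x) (G y)).re - 2 * (inner ℂ (V x - (μ : ℂ) • (x : H))
    (V y - (μ : ℂ) • (y : H))).re, fun s ↦ ?_⟩
  have h : V (x + (s : ℂ) • y) - (μ : ℂ) • ((x + (s : ℂ) • y : D) : H) =
      (V x - (μ : ℂ) • (x : H)) + (s : ℂ) • (V y - (μ : ℂ) • (y : H)) := by
    rw [map_add, map_smul, Submodule.coe_add, Submodule.coe_smul]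
    module
  rw [kgForm, h, norm_add_ofReal_smul_sq, map_add, map_smul, norm_add_ofReal_smul_sq, kgForm,
    kgForm]
  ring

theorem exists_kgHalfDeriv_add_smul (μ : ℝ) (x y : D) :
    ∃ c : ℝ, ∀ s : ℝ, kgHalfDeriv V μ (x + (s : ℂ) • y) =
      kgHalfDeriv V μ x + s * c + s ^ 2 * kgHalfDeriv V μ y := by
  refine ⟨(inner ℂ (V x - (μ : ℂ) • (x : H)) (y : H)).re +
    (inner ℂ (V y - (μ : ℂ) • (y : H)) (x : H)).re, fun s ↦ ?_⟩
  have h : V (x + (s : ℂ) • y) - (μ : ℂ) • ((x + (s : ℂ) • y : D) : H) =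
      (V x - (μ : ℂ) • (x : H)) + (s : ℂ) • (V y - (μ : ℂ) • (y : H)) := by
    rw [map_add, map_smul, Submodule.coe_add, Submodule.coe_smul]
    module
  rw [kgHalfDeriv, h, Submodule.coe_add, Submodule.coe_smul, inner_add_left, inner_add_right,
    inner_add_right, inner_smul_left, inner_smul_left, inner_smul_right, inner_smul_right,
    Complex.conj_ofReal, kgHalfDeriv, kgHalfDeriv]
  simp only [Complex.add_re, Complex.re_ofReal_mul]
  ring

theorem kgHalfDeriv_ofReal_smul (μ s : ℝ) (x : D) :
    kgHalfDeriv V μ ((s : ℂ) • x) = s ^ 2 * kgHalfDeriv V μ x := by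
  have h : V ((s : ℂ) • x) - (μ : ℂ) • (((s : ℂ) • x : D) : H) =
      (s : ℂ) • (V x - (μ : ℂ) • (x : H)) := by
    rw [map_smul, Submodule.coe_smul]
    module
  rw [kgHalfDeriv, h, Submodule.coe_smul, inner_smul_left, inner_smul_right, Complex.conj_ofReal,
    Complex.re_ofReal_mul, Complex.re_ofReal_mul, kgHalfDeriv]
  ring

variable {G V}

theorem kgHalfDeriv_eq_of_roots {x : D} {p q : ℝ} (hpq : p < q)
    (hp : kgForm G V p x = 0) (hq : kgForm G V q x = 0) (μ : ℝ) :
    2 * kgHalfDeriv V μ x = (p - μ + (q - μ)) * ‖(x : H)‖ ^ 2 := by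
  rw [kgForm_eq_taylor G V μ] at hp hq
  refine mul_left_cancel₀ (sub_pos.2 hpq).ne' ?_
  linear_combination hq - hp

theorem kgForm_eq_of_roots {x : D} {p q : ℝ} (hpq : p < q)
    (hp : kgForm G V p x = 0) (hq : kgForm G V q x = 0) (μ : ℝ) :
    kgForm G V μ x = -((p - μ) * (q - μ) * ‖(x : H)‖ ^ 2) := by
  have h := kgHalfDeriv_eq_of_roots hpq hp hq μ
  rw [kgForm_eq_taylor G V μ] at hp
  linear_combination hp - (p - μ) * h

/-- Every smaller root lies below every larger root. -/
theorem kgForm_root_lt_root {pm pp : D → ℝ}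
    (hsd : ∀ x : D, x ≠ 0 → pm x < pp x ∧ kgForm G V (pm x) x = 0 ∧ kgForm G V (pp x) x = 0)
    {x y : D} (hx : x ≠ 0) (hy : y ≠ 0) : pm x < pp y := by
  by_contra! hle
  have norm_pos : ∀ {z : D}, z ≠ 0 → 0 < ‖(z : H)‖ ^ 2 := fun hz ↦
    pow_pos (norm_pos_iff.2 (by simpa using hz)) 2
  obtain ⟨hxlt, hxm, hxp⟩ := hsd x hx
  obtain ⟨hylt, hym, hyp⟩ := hsd y hy
  set μ := pm x
  have hBx : 0 < kgHalfDeriv V μ x := by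
    have h := kgHalfDeriv_eq_of_roots hxlt hxm hxp μ
    nlinarith [mul_pos (sub_pos.2 hxlt) (norm_pos hx)]
  have hBy : kgHalfDeriv V μ y < 0 := by
    have h := kgHalfDeriv_eq_of_roots hylt hym hyp μ
    have := mul_neg_of_neg_of_pos (by linarith : pm y - μ + (pp y - μ) < 0) (norm_pos hy)
    linarith
  have hAy : kgForm G V μ y ≤ 0 := by
    rw [kgForm_eq_of_roots hylt hym hyp μ]
    exact neg_nonpos.2 (mul_nonneg
      (mul_nonneg_of_nonpos_of_nonpos (by linarith) (by linarith)) (norm_pos hy).le)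
  obtain ⟨c, hc⟩ := exists_kgForm_add_smul G V μ x y
  obtain ⟨b, hb⟩ := exists_kgHalfDeriv_add_smul V μ x y
  obtain ⟨s, hsc, hs⟩ := exists_root_of_opposite_signs_mul_nonpos (b := b) hBy hBx c
  rw [← hb] at hs
  have hAz : kgForm G V μ (x + (s : ℂ) • y) ≤ 0 := by
    rw [hc, hxm]
    nlinarith [mul_nonneg (sq_nonneg s) (neg_nonneg.2 hAy)]
  have hz : x + (s : ℂ) • y ≠ 0 := by
    intro h0
    have hx' : x = ((-s : ℝ) : ℂ) • y := by
      rw [eq_neg_of_add_eq_zero_left h0]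
      push_cast
      module
    rw [hx', kgHalfDeriv_ofReal_smul] at hBx
    nlinarith [mul_nonneg (sq_nonneg s) (neg_nonneg.2 hBy.le)]
  set z := x + (s : ℂ) • y
  obtain ⟨hzlt, hzm, hzp⟩ := hsd z hz
  have hsum := kgHalfDeriv_eq_of_roots hzlt hzm hzp μ
  rw [kgForm_eq_of_roots hzlt hzm hzp μ] at hAz
  rw [hs, mul_zero] at hsum
  have hsum0 : pm z - μ + (pp z - μ) = 0 :=
    (mul_eq_zero.1 hsum.symm).resolve_right (norm_pos hz).ne'
  have hpos : 0 < pp z - μ := by linarith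
  have hneg : pm z - μ < 0 := by linarith
  linarith [mul_neg_of_neg_of_pos (mul_neg_of_neg_of_pos hneg hpos) (norm_pos hz)]

end

/-- Lemma 3.2: if the form polynomial `t` is strongly damped with root functions
`p₋ = pm` and `p₊ = pp`, then `p₋(x) < p₊(y)` for all nonzero `x, y ∈ D`; in
particular the root zones `Λ₋` and `Λ₊` are disjoint and `sup Λ₋ ≤ inf Λ₊`. -/
theorem root_zones_separated
    {H : Type*} [NormedAddCommGroup H] [InnerProductSpace ℂ H]
    (D : Submodule ℂ H) (G V : D →ₗ[ℂ] H)
    (pm pp : D → ℝ)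
    (hsd : ∀ x : D, x ≠ 0 → pm x < pp x ∧
      kgForm G V (pm x) x = 0 ∧ kgForm G V (pp x) x = 0 ∧
      ∀ μ : ℝ, kgForm G V μ x = 0 → μ = pm x ∨ μ = pp x) :
    (∀ x y : D, x ≠ 0 → y ≠ 0 → pm x < pp y) ∧
    {r : ℝ | ∃ x : D, x ≠ 0 ∧ pm x = r} ∩ {r : ℝ | ∃ x : D, x ≠ 0 ∧ pp x = r} = ∅ ∧
    sSup {r : ℝ | ∃ x : D, x ≠ 0 ∧ pm x = r} ≤
      sInf {r : ℝ | ∃ x : D, x ≠ 0 ∧ pp x = r} := by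
  have hlt : ∀ x y : D, x ≠ 0 → y ≠ 0 → pm x < pp y := fun x y hx hy ↦
    kgForm_root_lt_root (fun z hz ↦ ⟨(hsd z hz).1, (hsd z hz).2.1, (hsd z hz).2.2.1⟩) hx hy
  refine ⟨hlt, ?_, ?_⟩
  · ext r
    simp only [Set.mem_inter_iff, Set.mem_ofPred_eq, Set.mem_empty_iff_false, iff_false]
    rintro ⟨⟨x, hx, rfl⟩, y, hy, hxy⟩
    exact (hlt x y hx hy).ne hxy.symm
  · by_cases h : ∃ x : D, x ≠ 0
    · obtain ⟨x₀, hx₀⟩ := h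
      refine csSup_le ⟨pm x₀, x₀, hx₀, rfl⟩ ?_
      rintro _ ⟨x, hx, rfl⟩
      refine le_csInf ⟨pp x₀, x₀, hx₀, rfl⟩ ?_
      rintro _ ⟨y, hy, rfl⟩
      exact (hlt x y hx hy).le
    · have hempty (f : D → ℝ) : {r : ℝ | ∃ x : D, x ≠ 0 ∧ f x = r} = ∅ :=
        Set.eq_empty_of_forall_notMem fun _ ⟨x, hx, _⟩ ↦ h ⟨x, hx⟩
      rw [hempty, hempty, Real.sSup_empty, Real.sInf_empty]
end

section
/- (Proposition 3.7 ii.) Assume there exist α ≥ 0 and β with 0 ≤ β < 1 such that ‖V x‖² ≤ α‖x‖² + β‖G x‖² for all x ∈ D (the relative form-bound condition (V2)). Suppose there exist λ₀ ∈ ℝ and γ₀ > 0 such that t(λ₀)[x] ≥ γ₀‖x‖² for all x ∈ D. Then the form polynomial t is strongly damped and there exists ε > 0 such that p_−(x) ≤ λ₀ − ε and p_+(x) ≥ λ₀ + ε for every x ∈ D ∖ {0}; in particular, if D contains a nonzero vector, then ν_− < λ₀ < ν_+. -/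
/-- Expansion of the Klein–Gordon form polynomial around `μ`. -/
theorem kgForm_add {H : Type*} [NormedAddCommGroup H] [InnerProductSpace ℂ H]
    {D : Submodule ℂ H} (G V : D →ₗ[ℂ] H) (μ s : ℝ) (x : D) :
    kgForm G V (μ + s) x = kgForm G V μ x
      + 2 * s * (inner ℂ (V x - (μ : ℂ) • (x : H)) (x : H)).re - s ^ 2 * ‖(x : H)‖ ^ 2 := by
  have hsplit : V x - ((μ + s : ℝ) : ℂ) • (x : H)
      = (V x - (μ : ℂ) • (x : H)) - (s : ℂ) • (x : H) := by
    push_cast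
    rw [add_smul]
    abel
  unfold kgForm
  rw [hsplit, norm_sub_sq (𝕜 := ℂ) (V x - (μ : ℂ) • (x : H)) ((s : ℂ) • (x : H)),
    inner_smul_right, norm_smul, RCLike.re_eq_complex_re, Complex.re_ofReal_mul, mul_pow,
    Complex.norm_real, Real.norm_eq_abs, sq_abs]
  ring

/-- The relative form bound and uniform positivity at `μ` control the linear coefficient of the
form polynomial at `μ` by its value there. -/
theorem exists_abs_re_inner_le_mul_kgForm {H : Type*} [NormedAddCommGroup H]
    [InnerProductSpace ℂ H] {D : Submodule ℂ H} (G V : D →ₗ[ℂ] H)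
    {α β : ℝ} (hα : 0 ≤ α) (hβ1 : β < 1)
    (hV : ∀ x : D, ‖V x‖ ^ 2 ≤ α * ‖(x : H)‖ ^ 2 + β * ‖G x‖ ^ 2)
    {μ γ : ℝ} (hγ : 0 < γ) (hlb : ∀ x : D, γ * ‖(x : H)‖ ^ 2 ≤ kgForm G V μ x) :
    ∃ K : ℝ, 0 < K ∧ ∀ x : D,
      |(inner ℂ (V x - (μ : ℂ) • (x : H)) (x : H)).re| ≤ K * kgForm G V μ x := by
  obtain ⟨δ, hδ, hδβ⟩ : ∃ δ : ℝ, 0 < δ ∧ (1 + δ) * β < 1 :=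
    ⟨(1 - β) / 2, by linarith, by nlinarith⟩
  set c : ℝ := (1 + δ) * α + (1 + 1 / δ) * μ ^ 2 with hc
  have hc0 : 0 ≤ c := by positivity
  set C : ℝ := (1 + c / γ) / (1 - (1 + δ) * β) with hC
  have hC0 : 0 < C := div_pos (by positivity) (by linarith)
  refine ⟨C / γ + 1, by positivity, fun x => ?_⟩
  set W : H := V x - (μ : ℂ) • (x : H) with hW
  set a : ℝ := kgForm G V μ x with ha
  have hn : γ * ‖(x : H)‖ ^ 2 ≤ a := hlb x
  have ha0 : 0 ≤ a := le_trans (by positivity) hn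
  have hnorm : ‖W‖ ≤ ‖V x‖ + |μ| * ‖(x : H)‖ := by
    refine (norm_sub_le _ _).trans_eq ?_
    rw [norm_smul, Complex.norm_real, Real.norm_eq_abs]
  have hyoung : ‖W‖ ^ 2 ≤ (1 + δ) * ‖V x‖ ^ 2 + (1 + 1 / δ) * μ ^ 2 * ‖(x : H)‖ ^ 2 := by
    have hsq : ‖W‖ ^ 2 ≤ (‖V x‖ + |μ| * ‖(x : H)‖) ^ 2 := by gcongr
    have hdiff : (1 + δ) * ‖V x‖ ^ 2 + (1 + 1 / δ) * |μ| ^ 2 * ‖(x : H)‖ ^ 2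
        - (‖V x‖ + |μ| * ‖(x : H)‖) ^ 2 = (δ * ‖V x‖ - |μ| * ‖(x : H)‖) ^ 2 / δ := by
      field_simp
      ring
    have hpos : 0 ≤ (δ * ‖V x‖ - |μ| * ‖(x : H)‖) ^ 2 / δ := by positivity
    rw [← sq_abs μ]
    linarith
  have hG : ‖G x‖ ^ 2 = a + ‖W‖ ^ 2 := by
    rw [ha, kgForm]
    ring
  have hx : ‖(x : H)‖ ^ 2 ≤ a / γ := by
    rw [le_div_iff₀ hγ]
    linarith
  have hWC : ‖W‖ ^ 2 ≤ C * a := by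
    have hV' := mul_le_mul_of_nonneg_left (hV x) (by positivity : 0 ≤ 1 + δ)
    have hcx := mul_le_mul_of_nonneg_left hx hc0
    have hβa := mul_le_mul_of_nonneg_right hδβ.le ha0
    rw [hG] at hV'
    rw [hC, div_mul_eq_mul_div, le_div_iff₀ (by linarith)]
    have hcγ : (1 + c / γ) * a = a + c * (a / γ) := by ring
    rw [hcγ]
    rw [hc] at hcx ⊢
    linarith
  have hr : |(inner ℂ W (x : H)).re| ≤ ‖W‖ * ‖(x : H)‖ :=
    (Complex.abs_re_le_norm _).trans (norm_inner_le_norm _ _)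
  refine (sq_le_sq₀ (abs_nonneg _) (by positivity)).1 ?_
  calc |(inner ℂ W (x : H)).re| ^ 2 ≤ (‖W‖ * ‖(x : H)‖) ^ 2 := by gcongr
    _ = ‖W‖ ^ 2 * ‖(x : H)‖ ^ 2 := mul_pow _ _ _
    _ ≤ (C * a) * (a / γ) := by gcongr
    _ = (C / γ) * a ^ 2 := by ring
    _ ≤ (C / γ + 1) ^ 2 * a ^ 2 := by
      have : 0 ≤ C / γ := by positivity
      gcongr
      nlinarith
    _ = ((C / γ + 1) * a) ^ 2 := (mul_pow _ _ _).symm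

/-- Factorization of a concave real quadratic that is nonnegative at the origin. -/
theorem quadratic_eq_neg_mul_sub_mul_sub {n a : ℝ} (hn : 0 < n) (ha : 0 ≤ a) (r s : ℝ) :
    a + 2 * s * r - s ^ 2 * n = -n * (s - (r - √(r ^ 2 + a * n)) / n)
      * (s - (r + √(r ^ 2 + a * n)) / n) := by
  have hd : √(r ^ 2 + a * n) ^ 2 = r ^ 2 + a * n := Real.sq_sqrt (by positivity)
  field_simp
  linear_combination -hd

/-- Proposition 3.7 ii): under the relative form-bound condition (V2),
if `t(λ₀)[x] ≥ γ₀‖x‖²` on `D` for some `λ₀ ∈ ℝ` and `γ₀ > 0`, then the form polynomial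
`t` is strongly damped and there is `ε > 0` with `p₋(x) ≤ λ₀ − ε` and `p₊(x) ≥ λ₀ + ε`
for every `x ∈ D ∖ {0}`; in particular `ν₋ < λ₀ < ν₊`. -/
theorem strongly_damped_of_uniformly_positive_form
    {H : Type*} [NormedAddCommGroup H] [InnerProductSpace ℂ H]
    (D : Submodule ℂ H) (G V : D →ₗ[ℂ] H)
    (α β : ℝ) (hα : 0 ≤ α) (hβ0 : 0 ≤ β) (hβ1 : β < 1)
    (hV : ∀ x : D, ‖V x‖ ^ 2 ≤ α * ‖(x : H)‖ ^ 2 + β * ‖G x‖ ^ 2)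
    (lam0 γ0 : ℝ) (hγ0 : 0 < γ0)
    (hlb : ∀ x : D, γ0 * ‖(x : H)‖ ^ 2 ≤ kgForm G V lam0 x) :
    ∃ ε : ℝ, 0 < ε ∧ ∃ pm pp : D → ℝ,
      (∀ x : D, x ≠ 0 → pm x < pp x ∧
        kgForm G V (pm x) x = 0 ∧ kgForm G V (pp x) x = 0 ∧
        (∀ μ : ℝ, kgForm G V μ x = 0 → μ = pm x ∨ μ = pp x) ∧
        pm x ≤ lam0 - ε ∧ lam0 + ε ≤ pp x) ∧
      ((∃ x : D, x ≠ 0) →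
        sSup {r : ℝ | ∃ x : D, x ≠ 0 ∧ pm x = r} < lam0 ∧
        lam0 < sInf {r : ℝ | ∃ x : D, x ≠ 0 ∧ pp x = r}) := by
  obtain ⟨K, hK, hKr⟩ := exists_abs_re_inner_le_mul_kgForm G V hα hβ1 hV hγ0 hlb
  set ε : ℝ := 1 / (2 * K + 1 / γ0 + 1) with hε
  have hε0 : 0 < ε := by positivity
  have hεmul : ε * (2 * K + 1 / γ0 + 1) = 1 := by
    rw [hε]
    field_simp
  have hε1 : ε ≤ 1 := by
    rw [hε, div_le_one (by positivity)]
    have : 0 < 1 / γ0 := by positivity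
    linarith
  let r : D → ℝ := fun x => (inner ℂ (V x - (lam0 : ℂ) • (x : H)) (x : H)).re
  let d : D → ℝ := fun x => √(r x ^ 2 + kgForm G V lam0 x * ‖(x : H)‖ ^ 2)
  let sm : D → ℝ := fun x => (r x - d x) / ‖(x : H)‖ ^ 2
  let sp : D → ℝ := fun x => (r x + d x) / ‖(x : H)‖ ^ 2
  have hroots : ∀ x : D, x ≠ 0 → sm x < sp x ∧
      (∀ s : ℝ, kgForm G V (lam0 + s) x = -‖(x : H)‖ ^ 2 * (s - sm x) * (s - sp x)) ∧
      sm x ≤ -ε ∧ ε ≤ sp x := by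
    intro x hx
    have hn : 0 < ‖(x : H)‖ ^ 2 := by
      have : (x : H) ≠ 0 := by simpa using hx
      positivity
    have hlbx := hlb x
    have ha : 0 < kgForm G V lam0 x := lt_of_lt_of_le (by positivity) hlbx
    have hd : 0 < d x := Real.sqrt_pos.2 (by positivity)
    have hlt : sm x < sp x := div_lt_div_of_pos_right (by linarith) hn
    have hfac : ∀ s : ℝ,
        kgForm G V (lam0 + s) x = -‖(x : H)‖ ^ 2 * (s - sm x) * (s - sp x) := fun s => by
      rw [kgForm_add]
      exact quadratic_eq_neg_mul_sub_mul_sub hn ha.le (r x) s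
    have hnonneg : ∀ s : ℝ, |s| = ε → sm x ≤ s ∧ s ≤ sp x := by
      intro s hs
      have hnx : ‖(x : H)‖ ^ 2 ≤ kgForm G V lam0 x * (1 / γ0) := by
        rw [mul_one_div, le_div_iff₀ hγ0]
        linarith
      have hsr : -(ε * (K * kgForm G V lam0 x)) ≤ s * r x := by
        refine neg_le_of_abs_le ?_
        rw [abs_mul, hs]
        exact mul_le_mul_of_nonneg_left (hKr x) hε0.le
      have hsn : s ^ 2 * ‖(x : H)‖ ^ 2 ≤ ε * (kgForm G V lam0 x * (1 / γ0)) := by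
        rw [← sq_abs, hs]
        have : ε ^ 2 ≤ ε := by nlinarith
        gcongr
      have hpos : 0 ≤ kgForm G V (lam0 + s) x := by
        have hkey : kgForm G V lam0 x - 2 * (ε * (K * kgForm G V lam0 x))
            - ε * (kgForm G V lam0 x * (1 / γ0)) = ε * kgForm G V lam0 x := by
          linear_combination -kgForm G V lam0 x * hεmul
        have : 0 < ε * kgForm G V lam0 x := by positivity
        have hexp : kgForm G V (lam0 + s) x
            = kgForm G V lam0 x + 2 * s * r x - s ^ 2 * ‖(x : H)‖ ^ 2 := kgForm_add G V lam0 s x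
        linarith
      rw [hfac] at hpos
      have hprod : (s - sm x) * (s - sp x) ≤ 0 := by
        by_contra! h
        nlinarith [mul_pos hn h]
      constructor <;> by_contra! h <;> nlinarith
    exact ⟨hlt, hfac, (hnonneg (-ε) (by rw [abs_neg, abs_of_pos hε0])).1,
      (hnonneg ε (abs_of_pos hε0)).2⟩
  refine ⟨ε, hε0, fun x => lam0 + sm x, fun x => lam0 + sp x, fun x hx => ?_, ?_⟩
  · obtain ⟨hlt, hfac, hm, hp⟩ := hroots x hx
    refine ⟨by linarith, by simp [hfac], by simp [hfac], fun μ hμ => ?_, by linarith, by linarith⟩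
    have hx' : (x : H) ≠ 0 := by simpa using hx
    rw [← add_sub_cancel lam0 μ, hfac] at hμ
    rcases mul_eq_zero.1 hμ with h | h
    · rcases mul_eq_zero.1 h with h | h
      · exact absurd h (by simpa using hx')
      · left
        linarith
    · right
      linarith
  · rintro ⟨x, hx⟩
    constructor
    · refine lt_of_le_of_lt (b := lam0 - ε) (csSup_le ⟨_, x, hx, rfl⟩ ?_) (by linarith)
      rintro _ ⟨y, hy, rfl⟩
      linarith [(hroots y hy).2.2.1]
    · refine lt_of_lt_of_le (b := lam0 + ε) (by linarith) (le_csInf ⟨_, x, hx, rfl⟩ ?_)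
      rintro _ ⟨y, hy, rfl⟩
      linarith [(hroots y hy).2.2.2]
end

section
/- (Lemma 4.1 i–ii, with the corrected range of λ in part i.) Assume there are a ≥ 0 and b with 0 ≤ b < 1 such that ‖V x‖ ≤ a‖x‖ + b‖G x‖ for all x ∈ D. Then: (i) for every λ ∈ ℝ with b(a + |λ|) ≤ (1 − b²)m, one has t(λ)[x] ≥ (m² − (a + b m + |λ|)²)‖x‖² for all x ∈ D; (ii) in particular, if a + b m < m, then for every λ ∈ ℝ with |λ| < m − (a + b m) the condition in (i) is automatically satisfied and t(λ)[x] ≥ (m² − (a + b m + |λ|)²)‖x‖² for all x ∈ D, where m² − (a + b m + |λ|)² > 0, so the form t(λ) is uniformly positive. -/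
theorem sq_sub_sq_lower_bound {m n g s b : ℝ} (hn : 0 ≤ n) (hb0 : 0 ≤ b) (hb1 : b < 1)
    (hg : m * n ≤ g) (hs : b * s ≤ (1 - b ^ 2) * m) :
    (m ^ 2 - (s + b * m) ^ 2) * n ^ 2 ≤ g ^ 2 - (s * n + b * g) ^ 2 := by
  have hb : 0 ≤ 1 - b ^ 2 := by nlinarith
  have h₁ : b * s * n ≤ (1 - b ^ 2) * m * n := mul_le_mul_of_nonneg_right hs hn
  have h₂ : 0 ≤ (1 - b ^ 2) * (g - m * n) := mul_nonneg hb (sub_nonneg.2 hg)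
  have h₃ : 0 ≤ (g - m * n) * ((1 - b ^ 2) * (g + m * n) - 2 * (b * s * n)) :=
    mul_nonneg (sub_nonneg.2 hg) (by linarith)
  linarith

theorem norm_sub_smul_le {H : Type*} [NormedAddCommGroup H] [InnerProductSpace ℂ H]
    {v x : H} {c : ℝ} (hv : ‖v‖ ≤ c) (μ : ℝ) :
    ‖v - (μ : ℂ) • x‖ ≤ c + |μ| * ‖x‖ := by
  calc ‖v - (μ : ℂ) • x‖ ≤ ‖v‖ + ‖(μ : ℂ) • x‖ := norm_sub_le _ _
    _ ≤ c + |μ| * ‖x‖ := by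
      rw [norm_smul, Complex.norm_real, Real.norm_eq_abs]
      gcongr

/-- Lemma 4.1 i)–ii) (with the corrected range of `λ` in part i): if
`‖V x‖ ≤ a‖x‖ + b‖G x‖` with `0 ≤ a`, `0 ≤ b < 1`, then (i) for every `λ` with
`b(a + |λ|) ≤ (1 − b²)m` one has `t(λ)[x] ≥ (m² − (a + bm + |λ|)²)‖x‖²`, and
(ii) if `a + bm < m`, then for `|λ| < m − (a + bm)` the condition of (i) holds
automatically and the lower bound is strictly positive. -/
theorem kg_form_lower_bound_relative_bound
    {H : Type*} [NormedAddCommGroup H] [InnerProductSpace ℂ H]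
    (m : ℝ) (hm : 0 < m) (D : Submodule ℂ H) (G V : D →ₗ[ℂ] H)
    (hG : ∀ x : D, m * ‖(x : H)‖ ≤ ‖G x‖)
    (a b : ℝ) (ha : 0 ≤ a) (hb0 : 0 ≤ b) (hb1 : b < 1)
    (hV : ∀ x : D, ‖V x‖ ≤ a * ‖(x : H)‖ + b * ‖G x‖) :
    (∀ lam : ℝ, b * (a + |lam|) ≤ (1 - b ^ 2) * m →
      ∀ x : D, (m ^ 2 - (a + b * m + |lam|) ^ 2) * ‖(x : H)‖ ^ 2 ≤ kgForm G V lam x) ∧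
    (a + b * m < m → ∀ lam : ℝ, |lam| < m - (a + b * m) →
      b * (a + |lam|) ≤ (1 - b ^ 2) * m ∧
      0 < m ^ 2 - (a + b * m + |lam|) ^ 2 ∧
      ∀ x : D, (m ^ 2 - (a + b * m + |lam|) ^ 2) * ‖(x : H)‖ ^ 2 ≤ kgForm G V lam x) := by
  have bound : ∀ lam : ℝ, b * (a + |lam|) ≤ (1 - b ^ 2) * m →
      ∀ x : D, (m ^ 2 - (a + b * m + |lam|) ^ 2) * ‖(x : H)‖ ^ 2 ≤ kgForm G V lam x := by
    intro lam hlam x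
    have h := sq_sub_sq_lower_bound (norm_nonneg (x : H)) hb0 hb1 (hG x) hlam
    have hsq : ‖V x - (lam : ℂ) • (x : H)‖ ^ 2 ≤
        ((a + |lam|) * ‖(x : H)‖ + b * ‖G x‖) ^ 2 := by
      refine pow_le_pow_left₀ (norm_nonneg _) ?_ 2
      linarith [norm_sub_smul_le (x := (x : H)) (hV x) lam]
    rw [add_right_comm a (b * m)]
    unfold kgForm
    linarith
  refine ⟨bound, fun _ lam hlam => ?_⟩
  have hs : b * (a + |lam|) ≤ (1 - b ^ 2) * m := by
    have h₁ : b * (a + |lam|) ≤ b * (m - b * m) :=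
      mul_le_mul_of_nonneg_left (by linarith) hb0
    have h₂ : 0 ≤ (1 - b) * m := mul_nonneg (by linarith) hm.le
    linarith
  refine ⟨hs, sub_pos.2 (pow_lt_pow_left₀ (by linarith) (by positivity) two_ne_zero), bound lam hs⟩
end

section
/- (Lemma 4.1 iii.) Suppose c ≥ 0 and ‖V x‖ ≤ c‖G x‖ for all x ∈ D. Then for every λ ∈ ℝ with c m + |λ| < m one has t(λ)[x] ≥ (m² − (c m + |λ|)²)‖x‖² for all x ∈ D, where m² − (c m + |λ|)² > 0; in particular the form t(λ) is uniformly positive for every λ with |λ| < m − c m. -/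
/-- On `[m * n, ∞)` the function `g ↦ g² − (c g + l n)²` is minimal at `g = m * n`,
provided `c m + l ≤ m`. -/
theorem sq_sub_sq_lower_bound_s13 {m c l n g : ℝ} (hm : 0 < m) (hc : 0 ≤ c) (hl : 0 ≤ l)
    (hn : 0 ≤ n) (h : c * m + l ≤ m) (hg : m * n ≤ g) :
    (m ^ 2 - (c * m + l) ^ 2) * n ^ 2 ≤ g ^ 2 - (c * g + l * n) ^ 2 := by
  have hc1 : 0 ≤ 1 - c := by
    by_contra! hlt
    nlinarith
  have hcl : c * l ≤ (1 - c ^ 2) * m := by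
    have h₁ : c * l ≤ c * (m - c * m) := mul_le_mul_of_nonneg_left (by linarith) hc
    have h₂ : 0 ≤ (1 - c) * m := mul_nonneg hc1 hm.le
    linarith
  have hcln : c * l * n ≤ (1 - c ^ 2) * m * n := mul_le_mul_of_nonneg_right hcl hn
  have hc2 : 0 ≤ 1 - c ^ 2 := by nlinarith
  have hfac : 0 ≤ (1 - c ^ 2) * (g + m * n) - 2 * (c * l * n) := by
    have := mul_nonneg hc2 (sub_nonneg.2 hg)
    linarith
  have := mul_nonneg (sub_nonneg.2 hg) hfac
  linarith

/-- Lemma 4.1 iii): if `‖V x‖ ≤ c‖G x‖` on `D` with `c ≥ 0` (and `‖G x‖ ≥ m‖x‖`,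
`m > 0`), then for every `λ ∈ ℝ` with `cm + |λ| < m` one has
`t(λ)[x] ≥ (m² − (cm + |λ|)²)‖x‖²` with `m² − (cm + |λ|)² > 0`; in particular
`t(λ)` is uniformly positive for `|λ| < m − cm`. -/
theorem kg_form_lower_bound_contraction
    {H : Type*} [NormedAddCommGroup H] [InnerProductSpace ℂ H]
    (m : ℝ) (hm : 0 < m) (D : Submodule ℂ H) (G V : D →ₗ[ℂ] H)
    (hG : ∀ x : D, m * ‖(x : H)‖ ≤ ‖G x‖)
    (c : ℝ) (hc : 0 ≤ c)
    (hV : ∀ x : D, ‖V x‖ ≤ c * ‖G x‖) :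
    ∀ lam : ℝ, c * m + |lam| < m →
      0 < m ^ 2 - (c * m + |lam|) ^ 2 ∧
      ∀ x : D, (m ^ 2 - (c * m + |lam|) ^ 2) * ‖(x : H)‖ ^ 2 ≤ kgForm G V lam x := by
  intro lam hlam
  have hcm : 0 ≤ c * m := mul_nonneg hc hm.le
  have hl : 0 ≤ |lam| := abs_nonneg lam
  refine ⟨sub_pos.2 (pow_lt_pow_left₀ hlam (add_nonneg hcm hl) two_ne_zero), fun x => ?_⟩
  have hVx : ‖V x - (lam : ℂ) • (x : H)‖ ≤ c * ‖G x‖ + |lam| * ‖(x : H)‖ := by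
    refine (norm_sub_le _ _).trans (add_le_add (hV x) ?_)
    rw [norm_smul, Complex.norm_real, Real.norm_eq_abs]
  calc (m ^ 2 - (c * m + |lam|) ^ 2) * ‖(x : H)‖ ^ 2
      ≤ ‖G x‖ ^ 2 - (c * ‖G x‖ + |lam| * ‖(x : H)‖) ^ 2 :=
        sq_sub_sq_lower_bound_s13 hm hc hl (norm_nonneg _) hlam.le (hG x)
    _ ≤ kgForm G V lam x :=
        sub_le_sub_left (pow_le_pow_left₀ (norm_nonneg _) hVx 2) _
end

section
/- (Proposition 2.1, the equivalences.) The following statements are equivalent: (i) there exists c with 0 ≤ c < 1 such that ‖V x‖ ≤ c‖G x‖ for all x ∈ D; (ii) there exist a, b ≥ 0 with a/m + b < 1 such that ‖V x‖ ≤ a‖x‖ + b‖G x‖ for all x ∈ D; (iii) there exist α, β ≥ 0 with √α/m + √β < 1 such that ‖V x‖² ≤ α‖x‖² + β‖G x‖² for all x ∈ D; (iv) there exist α, β ≥ 0 with α/m² + β < 1 such that ‖V x‖² ≤ α‖x‖² + β‖G x‖² for all x ∈ D. -/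
/-- Proposition 2.1, the equivalences: with `‖G x‖ ≥ m‖x‖` on `D` (`m > 0`), the
following are equivalent: (i) `‖V x‖ ≤ c‖G x‖` for some `0 ≤ c < 1`;
(ii) `‖V x‖ ≤ a‖x‖ + b‖G x‖` for some `a, b ≥ 0` with `a/m + b < 1`;
(iii) `‖V x‖² ≤ α‖x‖² + β‖G x‖²` for some `α, β ≥ 0` with `√α/m + √β < 1`;
(iv) `‖V x‖² ≤ α‖x‖² + β‖G x‖²` for some `α, β ≥ 0` with `α/m² + β < 1`. -/
theorem relative_bound_equivalences
    {H : Type*} [NormedAddCommGroup H] [InnerProductSpace ℂ H]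
    (m : ℝ) (hm : 0 < m) (D : Submodule ℂ H) (G V : D →ₗ[ℂ] H)
    (hG : ∀ x : D, m * ‖(x : H)‖ ≤ ‖G x‖) :
    ((∃ c : ℝ, 0 ≤ c ∧ c < 1 ∧ ∀ x : D, ‖V x‖ ≤ c * ‖G x‖) ↔
      (∃ a b : ℝ, 0 ≤ a ∧ 0 ≤ b ∧ a / m + b < 1 ∧
        ∀ x : D, ‖V x‖ ≤ a * ‖(x : H)‖ + b * ‖G x‖)) ∧
    ((∃ c : ℝ, 0 ≤ c ∧ c < 1 ∧ ∀ x : D, ‖V x‖ ≤ c * ‖G x‖) ↔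
      (∃ α β : ℝ, 0 ≤ α ∧ 0 ≤ β ∧ Real.sqrt α / m + Real.sqrt β < 1 ∧
        ∀ x : D, ‖V x‖ ^ 2 ≤ α * ‖(x : H)‖ ^ 2 + β * ‖G x‖ ^ 2)) ∧
    ((∃ c : ℝ, 0 ≤ c ∧ c < 1 ∧ ∀ x : D, ‖V x‖ ≤ c * ‖G x‖) ↔
      (∃ α β : ℝ, 0 ≤ α ∧ 0 ≤ β ∧ α / m ^ 2 + β < 1 ∧
        ∀ x : D, ‖V x‖ ^ 2 ≤ α * ‖(x : H)‖ ^ 2 + β * ‖G x‖ ^ 2)) := by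
  have norm_le_div : ∀ x : D, ‖(x : H)‖ ≤ ‖G x‖ / m := fun x => by
    rw [le_div_iff₀ hm, mul_comm]
    exact hG x
  have of_linear : (∃ a b : ℝ, 0 ≤ a ∧ 0 ≤ b ∧ a / m + b < 1 ∧
        ∀ x : D, ‖V x‖ ≤ a * ‖(x : H)‖ + b * ‖G x‖) →
      ∃ c : ℝ, 0 ≤ c ∧ c < 1 ∧ ∀ x : D, ‖V x‖ ≤ c * ‖G x‖ := by
    rintro ⟨a, b, ha, hb, hab, h⟩
    refine ⟨a / m + b, by positivity, hab, fun x => ?_⟩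
    calc ‖V x‖ ≤ a * ‖(x : H)‖ + b * ‖G x‖ := h x
      _ ≤ a * (‖G x‖ / m) + b * ‖G x‖ := by gcongr; exact norm_le_div x
      _ = (a / m + b) * ‖G x‖ := by ring
  have of_quadratic : (∃ α β : ℝ, 0 ≤ α ∧ 0 ≤ β ∧ α / m ^ 2 + β < 1 ∧
        ∀ x : D, ‖V x‖ ^ 2 ≤ α * ‖(x : H)‖ ^ 2 + β * ‖G x‖ ^ 2) →
      ∃ c : ℝ, 0 ≤ c ∧ c < 1 ∧ ∀ x : D, ‖V x‖ ≤ c * ‖G x‖ := by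
    rintro ⟨α, β, hα, hβ, hαβ, h⟩
    have hnn : 0 ≤ α / m ^ 2 + β := by positivity
    refine ⟨√(α / m ^ 2 + β), Real.sqrt_nonneg _, ?_, fun x => ?_⟩
    · rwa [Real.sqrt_lt' one_pos, one_pow]
    · refine (sq_le_sq₀ (norm_nonneg _) (by positivity)).mp ?_
      calc ‖V x‖ ^ 2 ≤ α * ‖(x : H)‖ ^ 2 + β * ‖G x‖ ^ 2 := h x
        _ ≤ α * (‖G x‖ / m) ^ 2 + β * ‖G x‖ ^ 2 := by gcongr; exact norm_le_div x
        _ = (√(α / m ^ 2 + β) * ‖G x‖) ^ 2 := by rw [mul_pow, Real.sq_sqrt hnn]; ring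
  have sq_bound : ∀ c : ℝ, (∀ x : D, ‖V x‖ ≤ c * ‖G x‖) →
      ∀ x : D, ‖V x‖ ^ 2 ≤ 0 * ‖(x : H)‖ ^ 2 + c ^ 2 * ‖G x‖ ^ 2 := fun c h x => by
    rw [zero_mul, zero_add, ← mul_pow]
    exact pow_le_pow_left₀ (norm_nonneg _) (h x) 2
  refine ⟨⟨?_, of_linear⟩, ⟨?_, ?_⟩, ⟨?_, of_quadratic⟩⟩
  · rintro ⟨c, hc, hc1, h⟩
    exact ⟨0, c, le_rfl, hc, by simpa using hc1, by simpa using h⟩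
  · rintro ⟨c, hc, hc1, h⟩
    exact ⟨0, c ^ 2, le_rfl, sq_nonneg c, by simpa [Real.sqrt_sq hc] using hc1, sq_bound c h⟩
  · rintro ⟨α, β, hα, hβ, hαβ, h⟩
    refine of_quadratic ⟨α, β, hα, hβ, ?_, h⟩
    have hs : 0 ≤ √α / m := by positivity
    have ht : 0 ≤ √β := Real.sqrt_nonneg β
    calc α / m ^ 2 + β = (√α / m) ^ 2 + √β ^ 2 := by
          rw [div_pow, Real.sq_sqrt hα, Real.sq_sqrt hβ]
      _ < 1 := by nlinarith [mul_nonneg hs ht]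
  · rintro ⟨c, hc, hc1, h⟩
    refine ⟨0, c ^ 2, le_rfl, sq_nonneg c, ?_, sq_bound c h⟩
    rw [zero_div, zero_add]
    exact pow_lt_one₀ hc hc1 two_ne_zero
end

section
/- (Remark 2.8: a compactly perturbed contraction gives the relative bound (V2′).) For every ε > 0 there exists a ≥ 0 such that ‖S₁(G x)‖ ≤ a‖x‖ + ε‖G x‖ for all x ∈ D (the composition S₁ ∘ G is relatively bounded with respect to G with relative bound 0). Consequently, if in addition ‖S₀‖ < 1 and V : D → H is defined by V x := (S₀ + S₁)(G x), then there exist a ≥ 0 and b with 0 ≤ b < 1 such that ‖V x‖ ≤ a‖x‖ + b‖G x‖ for all x ∈ D. -/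
/-- A point outside a closed subspace is separated from it by a continuous functional. -/
theorem Submodule.exists_strongDual_eq_zero_of_notMem {𝕜 E : Type*} [RCLike 𝕜]
    [NormedAddCommGroup E] [NormedSpace 𝕜 E] (N : Submodule 𝕜 E) (hN : IsClosed (N : Set E))
    {x : E} (hx : x ∉ N) : ∃ f : StrongDual 𝕜 E, (∀ y ∈ N, f y = 0) ∧ f x ≠ 0 := by
  have : IsClosed (N : Set E) := hN
  have hx' : N.mkQL x ≠ 0 := fun h => hx ((Submodule.Quotient.mk_eq_zero N).1 h)
  obtain ⟨g, -, hg⟩ := exists_dual_vector 𝕜 (N.mkQL x) (norm_ne_zero_iff.2 hx')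
  refine ⟨g.comp N.mkQL, fun y hy => ?_, ?_⟩
  · have : N.mkQL y = 0 := (Submodule.Quotient.mk_eq_zero N).2 hy
    simp [this]
  · rw [ContinuousLinearMap.comp_apply, hg]
    exact_mod_cast norm_ne_zero_iff.2 hx'

section

variable {𝕜 E F : Type*} [RCLike 𝕜] [NormedAddCommGroup E] [InnerProductSpace 𝕜 E]
  [NormedAddCommGroup F] [InnerProductSpace 𝕜 F] [CompleteSpace F]

/-- The vectors `w` for which `x ↦ ⟪w, T x⟫` is continuous are dense when `T` is closable. -/
theorem LinearPMap.IsClosable.dense_adjointDomain {T : E →ₗ.[𝕜] F} (hT : T.IsClosable) :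
    Dense (T.adjointDomain : Set F) := by
  rw [Submodule.dense_iff_topologicalClosure_eq_top, Submodule.topologicalClosure_eq_top_iff,
    Submodule.eq_bot_iff]
  intro v hv
  by_contra hv0
  have hnot : ((0 : E), v) ∉ T.graph.topologicalClosure := by
    rw [hT.graph_closure_eq_closure_graph]
    exact fun h => hv0 (T.closure.graph_fst_eq_zero_snd h rfl)
  obtain ⟨f, hf, hfv⟩ := Submodule.exists_strongDual_eq_zero_of_notMem _
    T.graph.isClosed_topologicalClosure hnot
  set w : F := (InnerProductSpace.toDual 𝕜 F).symm (f.comp (ContinuousLinearMap.inr 𝕜 E F))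
  have hw (y : F) : inner 𝕜 w y = f (0, y) := by
    simp [w]
  have hwT : w ∈ T.adjointDomain := by
    have hcont : Continuous fun x : T.domain => -f ((x : E), 0) := by fun_prop
    refine hcont.congr fun x => ?_
    have hx := hf _ (T.graph.le_topologicalClosure (T.mem_graph x))
    have hsum : f ((x : E), T x) = f ((x : E), 0) + f (0, T x) := by
      simpa using f.map_add ((x : E), (0 : F)) (0, T x)
    rw [hsum] at hx
    change _ = inner 𝕜 w (T x)
    rw [hw]
    exact neg_eq_of_add_eq_zero_right hx
  exact hfv ((hw v).symm.trans (hv w hwT))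

/-- For closable `T`, each functional `x ↦ ⟪v, T x⟫` has `T`-bound zero. -/
theorem LinearPMap.IsClosable.exists_norm_inner_le {T : E →ₗ.[𝕜] F} (hT : T.IsClosable)
    (v : F) {δ : ℝ} (hδ : 0 < δ) :
    ∃ a : ℝ, 0 ≤ a ∧ ∀ x : T.domain, ‖inner 𝕜 v (T x)‖ ≤ a * ‖(x : E)‖ + δ * ‖T x‖ := by
  obtain ⟨w, hw, hvw⟩ := hT.dense_adjointDomain.exists_dist_lt v hδ
  refine ⟨‖T.adjointDomainMkCLM ⟨w, hw⟩‖, norm_nonneg _, fun x => ?_⟩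
  have h₁ : ‖inner 𝕜 w (T x)‖ ≤ ‖T.adjointDomainMkCLM ⟨w, hw⟩‖ * ‖(x : E)‖ :=
    (T.adjointDomainMkCLM ⟨w, hw⟩).le_opNorm x
  have h₂ : ‖inner 𝕜 (v - w) (T x)‖ ≤ δ * ‖T x‖ :=
    (norm_inner_le_norm _ _).trans (by rw [← dist_eq_norm]; gcongr)
  calc ‖inner 𝕜 v (T x)‖ = ‖inner 𝕜 w (T x) + inner 𝕜 (v - w) (T x)‖ := by
        rw [← inner_add_left, add_sub_cancel]
    _ ≤ _ := (norm_add_le _ _).trans (add_le_add h₁ h₂)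

end

/-- A compact operator is controlled, up to an arbitrarily small multiple of the norm, by
finitely many continuous functionals. -/
theorem IsCompactOperator.exists_finite_strongDual_norm_le {𝕜 E F : Type*} [RCLike 𝕜]
    [NormedAddCommGroup E] [NormedSpace 𝕜 E] [NormedAddCommGroup F] [NormedSpace 𝕜 F]
    {S : E →L[𝕜] F} (hS : IsCompactOperator S) {δ : ℝ} (hδ : 0 < δ) :
    ∃ t : Set (StrongDual 𝕜 E), t.Finite ∧ ∀ y, ∃ f ∈ t, ‖S y‖ ≤ ‖f y‖ + δ * ‖y‖ := by
  obtain ⟨K, hK, hSK⟩ := hS.image_closedBall_subset_compact (f := (S : E →ₗ[𝕜] F)) 1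
  obtain ⟨c, -, hc, hKc⟩ := hK.finite_cover_balls (half_pos hδ)
  choose g hg hgc using fun z : F => exists_dual_vector'' 𝕜 z
  refine ⟨(fun z => (g z).comp S) '' c, hc.image _, fun y => ?_⟩
  have key (u : E) (hu : ‖u‖ ≤ 1) : ∃ z ∈ c, ‖S u‖ ≤ ‖g z (S u)‖ + δ := by
    obtain ⟨z, hz, huz⟩ := Set.mem_iUnion₂.1
      (hKc (hSK ⟨u, mem_closedBall_zero_iff.2 hu, rfl⟩))
    replace huz : ‖S u - z‖ < δ / 2 := by simpa [dist_eq_norm] using huz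
    refine ⟨z, hz, ?_⟩
    have h₁ : ‖S u‖ ≤ ‖z‖ + ‖S u - z‖ := by
      simpa using norm_add_le z (S u - z)
    have h₂ : ‖z‖ ≤ ‖g z (S u)‖ + ‖g z (S u - z)‖ := by
      have h := norm_sub_le (g z (S u)) (g z (S u - z))
      rwa [← map_sub, sub_sub_cancel, hgc, RCLike.norm_ofReal, abs_norm] at h
    have h₃ : ‖g z (S u - z)‖ ≤ ‖S u - z‖ := by
      simpa using (g z).le_of_opNorm_le (hg z) (S u - z)
    linarith
  rcases eq_or_ne y 0 with rfl | hy
  · obtain ⟨z, hz, -⟩ := key 0 (by simp)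
    exact ⟨_, ⟨z, hz, rfl⟩, by simp⟩
  · have hy' : 0 < ‖y‖ := norm_pos_iff.2 hy
    obtain ⟨z, hz, h⟩ := key (((‖y‖⁻¹ : ℝ) : 𝕜) • y) (by simp [norm_smul, hy'.ne'])
    refine ⟨_, ⟨z, hz, rfl⟩, ?_⟩
    simp only [map_smul, norm_smul, RCLike.norm_ofReal, abs_inv, abs_norm] at h
    have := mul_le_mul_of_nonneg_left h hy'.le
    rw [mul_add, mul_inv_cancel_left₀ hy'.ne', mul_inv_cancel_left₀ hy'.ne'] at this
    rw [mul_comm δ]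
    exact this

/-- If `T` is closable and `S` is compact, then `S ∘ T` has `T`-bound zero. -/
theorem LinearPMap.IsClosable.exists_norm_isCompactOperator_comp_le {𝕜 E F K : Type*} [RCLike 𝕜]
    [NormedAddCommGroup E] [InnerProductSpace 𝕜 E] [NormedAddCommGroup F]
    [InnerProductSpace 𝕜 F] [CompleteSpace F] [NormedAddCommGroup K] [NormedSpace 𝕜 K]
    {T : E →ₗ.[𝕜] F} (hT : T.IsClosable) {S : F →L[𝕜] K} (hS : IsCompactOperator S)
    {ε : ℝ} (hε : 0 < ε) :
    ∃ a : ℝ, 0 ≤ a ∧ ∀ x : T.domain, ‖S (T x)‖ ≤ a * ‖(x : E)‖ + ε * ‖T x‖ := by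
  obtain ⟨t, ht, htS⟩ := hS.exists_finite_strongDual_norm_le (half_pos hε)
  choose a ha haT using fun f : StrongDual 𝕜 F =>
    hT.exists_norm_inner_le ((InnerProductSpace.toDual 𝕜 F).symm f) (half_pos hε)
  refine ⟨∑ f ∈ ht.toFinset, a f, Finset.sum_nonneg fun f _ => ha f, fun x => ?_⟩
  obtain ⟨f, hf, hfx⟩ := htS (T x)
  have h₁ := haT f x
  rw [InnerProductSpace.toDual_symm_apply] at h₁
  have h₂ : a f * ‖(x : E)‖ ≤ (∑ f ∈ ht.toFinset, a f) * ‖(x : E)‖ := by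
    gcongr
    exact Finset.single_le_sum (fun f _ => ha f) (ht.mem_toFinset.2 hf)
  linarith

/-- Remark 2.8: let `G` be a densely defined closable operator in a complex Hilbert
space `H`, and let `S₀, S₁ : H → H` be bounded with `S₁` compact. Then `S₁ ∘ G` is
`G`-bounded with relative bound `0`; consequently, if moreover `‖S₀‖ < 1`, then
`V := (S₀ + S₁) ∘ G` satisfies the relative bound condition (V2′):
`‖V x‖ ≤ a‖x‖ + b‖G x‖` for some `a ≥ 0` and `0 ≤ b < 1`. -/
theorem compactly_perturbed_contraction_relative_bound
    {H : Type*} [NormedAddCommGroup H] [InnerProductSpace ℂ H] [CompleteSpace H]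
    (G : H →ₗ.[ℂ] H) (hdense : Dense (G.domain : Set H)) (hclosable : G.IsClosable)
    (S₀ S₁ : H →L[ℂ] H) (hS₁ : IsCompactOperator S₁) :
    (∀ ε : ℝ, 0 < ε → ∃ a : ℝ, 0 ≤ a ∧
      ∀ x : G.domain, ‖S₁ (G x)‖ ≤ a * ‖(x : H)‖ + ε * ‖G x‖) ∧
    (‖S₀‖ < 1 → ∃ a b : ℝ, 0 ≤ a ∧ 0 ≤ b ∧ b < 1 ∧
      ∀ x : G.domain, ‖(S₀ + S₁) (G x)‖ ≤ a * ‖(x : H)‖ + b * ‖G x‖) := by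
  refine ⟨fun ε hε => hclosable.exists_norm_isCompactOperator_comp_le hS₁ hε, fun hS₀ => ?_⟩
  obtain ⟨a, ha, h⟩ := hclosable.exists_norm_isCompactOperator_comp_le hS₁
    (half_pos (sub_pos.2 hS₀))
  refine ⟨a, ‖S₀‖ + (1 - ‖S₀‖) / 2, ha, by linarith [norm_nonneg S₀], by linarith, fun x => ?_⟩
  calc ‖(S₀ + S₁) (G x)‖ ≤ ‖S₀ (G x)‖ + ‖S₁ (G x)‖ := norm_add_le _ _
    _ ≤ ‖S₀‖ * ‖G x‖ + (a * ‖(x : H)‖ + (1 - ‖S₀‖) / 2 * ‖G x‖) :=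
        add_le_add (S₀.le_opNorm _) (h x)
    _ = a * ‖(x : H)‖ + (‖S₀‖ + (1 - ‖S₀‖) / 2) * ‖G x‖ := by ring
end
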